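/- arXiv:2311.17497 — 3 statements merged into one kernel-verified Lean document; each statement's English description precedes it below -/
import Mathlib

section
/- Let H be a real Hilbert space and let K : H → P(H) be a multivalued map such that: (i) each value K(x) is nonempty, closed, bounded and convex; (ii) K is upper semicontinuous, i.e. for every x ∈ H and every open set U ⊇ K(x) there is a neighborhood V of x with K(x') ⊆ U for all x' ∈ V; (iii) K is completely continuous, i.e. the image ⋃_{x∈A} K(x) of every bounded set A ⊆ H is relatively compact. If the set M = { x ∈ H : λ·x ∈ K(x) for some real λ > 1 } is bounded, then K has a fixed point, i.e. there exists x ∈ H with x ∈ K(x). -/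
open Metric Set Filter Topology MeasureTheory
open scoped RealInnerProductSpace

theorem exists_det_one_add_eq_sum (E : Type*) [NormedAddCommGroup E] [NormedSpace ℝ E]
    [FiniteDimensional ℝ E] (s : Finset ℝ) (hs : Module.finrank ℝ E < s.card) :
    ∃ c : ℝ → ℝ, ∑ t ∈ s, c t = 1 ∧
      ∀ A : E →L[ℝ] E, (1 + A).det = ∑ t ∈ s, c t * (1 + t • A).det := by
  have hne : s.Nonempty := Finset.card_pos.mp (by omega)
  have hinj : InjOn (id : ℝ → ℝ) s := injOn_id _
  refine ⟨fun t => (Lagrange.basis s id t).eval 1, ?_, fun A => ?_⟩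
  · rw [← Polynomial.eval_finsetSum, Lagrange.sum_basis hinj hne, Polynomial.eval_one]
  · let b := Module.finBasis ℝ E
    let M := LinearMap.toMatrix b b (A : E →ₗ[ℝ] E)
    let p : Polynomial ℝ :=
      Matrix.det ((Polynomial.X : Polynomial ℝ) • M.map Polynomial.C +
        (1 : Matrix _ _ ℝ).map Polynomial.C)
    have hp : ∀ t : ℝ, p.eval t = (1 + t • A).det := by
      intro t
      have h1 : (1 + t • A).det = Matrix.det (1 + t • M) := by
        rw [ContinuousLinearMap.det, ← LinearMap.det_toMatrix b]
        congr 1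
        simp [M, LinearMap.toMatrix_one]
      rw [h1, ← Polynomial.coe_evalRingHom, RingHom.map_det]
      congr 1
      ext i j
      simp only [RingHom.mapMatrix_apply, Matrix.map_apply, Matrix.add_apply, Matrix.smul_apply,
        smul_eq_mul, Polynomial.coe_evalRingHom, Polynomial.eval_add, Polynomial.eval_mul, Polynomial.eval_X,
        Polynomial.eval_C]
      ring
    have hdeg : p.degree < s.card := by
      refine lt_of_le_of_lt Polynomial.degree_le_natDegree ?_
      have := Polynomial.natDegree_det_X_add_C_le M 1
      simp only [Fintype.card_fin] at this
      exact_mod_cast this.trans_lt hs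
    have h := congrArg (Polynomial.eval 1) (Lagrange.eq_interpolate hinj hdeg)
    rw [hp, one_smul, Lagrange.interpolate_apply, Polynomial.eval_finsetSum] at h
    rw [h]
    refine Finset.sum_congr rfl fun t _ => ?_
    simp [hp, mul_comm]

theorem bijective_add_smul_of_lipschitzWith {E : Type*} [NormedAddCommGroup E] [NormedSpace ℝ E]
    [CompleteSpace E] {g : E → E} {L : NNReal} (hg : LipschitzWith L g) {t : ℝ}
    (ht : ‖t‖₊ * L < 1) : Function.Bijective fun x => x + t • g x := by
  have hc : ∀ y, ContractingWith (‖t‖₊ * L) fun x => y - t • g x := by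
    refine fun y => ⟨ht, LipschitzWith.of_dist_le_mul fun a b => ?_⟩
    rw [dist_sub_left, dist_smul₀, NNReal.coe_mul, coe_nnnorm, mul_assoc]
    gcongr
    exact hg.dist_le_mul a b
  refine ⟨fun a b hab => ?_, fun y => ?_⟩
  · simp only at hab
    refine (hc (a + t • g a)).fixedPoint_unique' ?_ ?_
    · simp [Function.IsFixedPt]
    · simp [Function.IsFixedPt, hab]
  · have := (hc y).fixedPoint_isFixedPt
    exact ⟨_, by rw [← eq_sub_iff_add_eq]; exact this.symm⟩

theorem image_add_smul_eq_self {E : Type*} [NormedAddCommGroup E] [NormedSpace ℝ E]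
    [CompleteSpace E] {g : E → E} {L : NNReal} (hg : LipschitzWith L g) {t : ℝ}
    (ht : ‖t‖₊ * L < 1) {s : Set E} (hs : ∀ x, x ∉ s → g x = 0) :
    (fun x => x + t • g x) '' s = s := by
  have hb := bijective_add_smul_of_lipschitzWith hg ht
  have hc : (fun x => x + t • g x) '' sᶜ = sᶜ := by
    conv_rhs => rw [← image_id sᶜ]
    exact image_congr fun x hx => by simp [hs x hx]
  rw [image_compl_eq hb] at hc
  exact compl_injective hc

theorem lipschitzWith_indicator {E F : Type*} [NormedAddCommGroup E] [NormedSpace ℝ E]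
    [NormedAddCommGroup F] {g : E → F} {L : NNReal}
    {s : Set E} (hs : IsClosed s) (hg : LipschitzOnWith L g s)
    (h0 : ∀ x ∈ frontier s, g x = 0) : LipschitzWith L (s.indicator g) := by
  have key : ∀ x ∈ s, ∀ y ∉ s, dist (s.indicator g x) (s.indicator g y) ≤ L * dist x y := by
    intro x hx y hy
    obtain ⟨z, hz, hzf⟩ : (segment ℝ x y ∩ frontier s).Nonempty := by
      by_contra! hemp
      have hint : ∀ z ∈ segment ℝ x y, z ∈ s → z ∈ interior s := fun z hz hzs => by
        by_contra hzi
        exact hemp.subset ⟨hz, hs.frontier_eq.symm ▸ ⟨hzs, hzi⟩⟩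
      obtain ⟨z, -, hzi, hzs⟩ := (convex_segment x y).isPreconnected _ _ isOpen_interior
        hs.isOpen_compl (fun z hz => or_iff_not_imp_right.mpr fun h => hint z hz (not_not.mp h))
        ⟨x, left_mem_segment ℝ x y, hint x (left_mem_segment ℝ x y) hx⟩
        ⟨y, right_mem_segment ℝ x y, hy⟩
      exact hzs (interior_subset hzi)
    have hzs : z ∈ s := hs.frontier_subset hzf
    rw [indicator_of_mem hx, indicator_of_notMem hy, ← h0 z hzf]
    refine (hg.dist_le_mul x hx z hzs).trans ?_
    gcongr
    have := dist_add_dist_of_mem_segment hz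
    linarith [dist_nonneg (x := z) (y := y)]
  refine LipschitzWith.of_dist_le_mul fun x y => ?_
  by_cases hx : x ∈ s <;> by_cases hy : y ∈ s
  · rw [indicator_of_mem hx, indicator_of_mem hy]
    exact hg.dist_le_mul x hx y hy
  · exact key x hx y hy
  · rw [dist_comm, dist_comm x]
    exact key y hy x hx
  · rw [indicator_of_notMem hx, indicator_of_notMem hy, dist_self]
    positivity

theorem no_contDiffOn_retraction {E : Type*} [NormedAddCommGroup E] [InnerProductSpace ℝ E]
    [FiniteDimensional ℝ E] {r : E → E} {U : Set E} (hU : IsOpen U)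
    (hBU : closedBall (0 : E) 1 ⊆ U) (hr : ContDiffOn ℝ 1 r U)
    (hnorm : ∀ x ∈ closedBall (0 : E) 1, ‖r x‖ = 1)
    (hid : ∀ x ∈ sphere (0 : E) 1, r x = x) : False := by
  borelize E
  let μ : Measure E := Measure.addHaar
  set B := closedBall (0 : E) 1
  have hBc : IsCompact B := isCompact_closedBall 0 1
  have hBm : MeasurableSet B := measurableSet_closedBall
  let g : E → E := fun x => r x - x
  have hg : ContDiffOn ℝ 1 g U := hr.sub contDiffOn_id
  obtain ⟨L, hL⟩ := (hg.mono hBU).exists_lipschitzOnWith one_ne_zero (convex_closedBall 0 1) hBc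
  have hG := lipschitzWith_indicator isClosed_closedBall hL fun x hx => by
    have := frontier_closedBall_subset_sphere hx
    simp [g, hid x this]
  let A : E → E →L[ℝ] E := fderiv ℝ g
  have hA : ContinuousOn A B := (hg.continuousOn_fderiv_of_isOpen hU le_rfl).mono hBU
  have hgA : ∀ x ∈ B, HasFDerivAt g (A x) x := fun x hx =>
    ((hg.contDiffAt (hU.mem_nhds (hBU hx))).differentiableAt one_ne_zero).hasFDerivAt
  have hint : ∀ t : ℝ, IntegrableOn (fun x => (1 + t • A x).det) B μ := fun t =>
    (ContinuousLinearMap.continuous_det.comp_continuousOn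
      (continuousOn_const.add (hA.const_smul t))).integrableOn_compact hBc
  obtain ⟨C, hC⟩ := (hBc.image_of_continuousOn hA).isBounded.exists_norm_le
  have hsmall : ∀ᶠ t : ℝ in 𝓝 0, ∫ x in B, (1 + t • A x).det ∂μ = μ.real B := by
    have hpos : ∀ᶠ T : E →L[ℝ] E in 𝓝 0, 0 < (1 + T).det := by
      have hcont : Continuous fun T : E →L[ℝ] E => (1 + T).det :=
        ContinuousLinearMap.continuous_det.comp (continuous_const.add continuous_id)
      refine hcont.continuousAt.eventually_const_lt ?_
      simp [ContinuousLinearMap.det]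
    obtain ⟨δ, hδ, hδpos⟩ := Metric.eventually_nhds_iff.mp hpos
    have h1 : ∀ᶠ t : ℝ in 𝓝 0, ‖t‖₊ * L < 1 := by
      have : Continuous fun t : ℝ => ‖t‖₊ * L := by fun_prop
      exact this.continuousAt.eventually_lt_const (by simp)
    have h2 : ∀ᶠ t : ℝ in 𝓝 0, ‖t‖ * C < δ := by
      have : Continuous fun t : ℝ => ‖t‖ * C := by fun_prop
      exact this.continuousAt.eventually_lt_const (by simpa using hδ)
    filter_upwards [h1, h2] with t ht1 ht2
    have heq : EqOn (fun x => x + t • B.indicator g x) (fun x => x + t • g x) B := fun x hx => by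
      simp [indicator_of_mem hx]
    have himg : (fun x => x + t • g x) '' B = B := by
      rw [← heq.image_eq]
      exact image_add_smul_eq_self hG ht1 fun x hx => indicator_of_notMem hx g
    have hinj : InjOn (fun x => x + t • g x) B :=
      ((bijective_add_smul_of_lipschitzWith hG ht1).injective.injOn).congr heq
    have hcv := integral_image_eq_integral_abs_det_fderiv_smul μ hBm
      (f' := fun x => 1 + t • A x)
      (fun x hx => ((hasFDerivAt_id x).add ((hgA x hx).const_smul t)).hasFDerivWithinAt) hinj
      (fun _ => (1 : ℝ))
    change ∫ x in (fun x => x + t • g x) '' B, (1 : ℝ) ∂μ = _ at hcv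
    rw [himg, setIntegral_const, smul_eq_mul, mul_one] at hcv
    rw [hcv]
    refine setIntegral_congr_fun hBm fun x hx => ?_
    have : 0 < (1 + t • A x).det := by
      refine hδpos ?_
      rw [dist_zero_right, norm_smul]
      exact lt_of_le_of_lt (by gcongr; exact hC _ (mem_image_of_mem A hx)) ht2
    simp [abs_of_pos this]
  obtain ⟨s, hs, hcard⟩ : ∃ s : Finset ℝ,
      (∀ t ∈ s, ∫ x in B, (1 + t • A x).det ∂μ = μ.real B) ∧
        s.card = Module.finrank ℝ E + 1 := by
    obtain ⟨s, hs, hcard⟩ := (infinite_of_mem_nhds (0 : ℝ) hsmall).exists_subset_card_eq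
      (Module.finrank ℝ E + 1)
    exact ⟨s, fun t ht => hs ht, hcard⟩
  obtain ⟨c, hc1, hc⟩ := exists_det_one_add_eq_sum E s (by omega)
  have hvol : ∫ x in B, (1 + A x).det ∂μ = μ.real B := by
    rw [show (fun x => (1 + A x).det) = fun x => ∑ t ∈ s, c t * (1 + t • A x).det from
      funext fun x => hc (A x), integral_finsetSum _ fun t _ => (hint t).const_mul (c t)]
    simp_rw [integral_const_mul]
    rw [Finset.sum_congr rfl fun t ht => by rw [hs t ht], ← Finset.sum_mul, hc1, one_mul]
  have hzero : ∫ x in B, (1 + A x).det ∂μ = 0 := by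
    have hdet : ∀ x ∈ ball (0 : E) 1, (1 + A x).det = 0 := by
      intro x hx
      by_contra hne
      have hxB : x ∈ B := ball_subset_closedBall hx
      have hrx : HasFDerivAt r (1 + A x) x := by
        have := (hasFDerivAt_id x).add (hgA x hxB)
        exact this.congr_of_eventuallyEq (Eventually.of_forall fun y => by simp [g])
      have hconst : (fun y => ‖r y‖ ^ 2) =ᶠ[𝓝 x] fun _ => (1 : ℝ) := by
        filter_upwards [isOpen_ball.mem_nhds hx] with y hy
        simp [hnorm y (ball_subset_closedBall hy)]
      have hd := (hrx.norm_sq.congr_of_eventuallyEq hconst.symm).unique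
        (hasFDerivAt_const (1 : ℝ) x)
      obtain ⟨v, hv⟩ : ∃ v, (1 + A x) v = r x := by
        have := (LinearMap.equivOfDetNeZero _ hne).surjective (r x)
        exact this
      have := DFunLike.congr_fun hd v
      simp only [smul_apply, ContinuousLinearMap.comp_apply, hv] at this
      simp [hnorm x hxB] at this
    refine integral_eq_zero_of_ae ((ae_restrict_iff' hBm).mpr ?_)
    filter_upwards [compl_mem_ae_iff.mpr
      (Measure.addHaar_sphere_of_ne_zero μ (0 : E) one_ne_zero)] with x hxs hxB
    exact hdet x (lt_of_le_of_ne hxB hxs)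
  have : 0 < μ.real B := by
    refine ENNReal.toReal_pos (measure_closedBall_pos μ 0 one_pos).ne' hBc.measure_lt_top.ne
  linarith

theorem exists_fixedPoint_of_contDiff {E : Type*} [NormedAddCommGroup E] [InnerProductSpace ℝ E]
    [FiniteDimensional ℝ E] {p : E → E} (hp : ContDiff ℝ 1 p)
    (hmaps : ∀ x ∈ closedBall (0 : E) 1, ‖p x‖ < 1) : ∃ x ∈ closedBall (0 : E) 1, p x = x := by
  by_contra! hfix
  let u : E → E := fun x => x - p x
  have hu : ContDiff ℝ 1 u := contDiff_id.sub hp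
  let D : E → ℝ := fun x => ⟪x, u x⟫ ^ 2 + ‖u x‖ ^ 2 * (1 - ‖x‖ ^ 2)
  have hD : ContDiff ℝ 1 D :=
    ((contDiff_id.inner ℝ hu).pow 2).add
      ((hu.norm_sq ℝ).mul (contDiff_const.sub (contDiff_id.norm_sq ℝ)))
  let τ : E → ℝ := fun x => (-⟪x, u x⟫ + √(D x)) / ‖u x‖ ^ 2
  let U : Set E := {x | u x ≠ 0} ∩ {x | 0 < D x}
  have hU : IsOpen U :=
    (isOpen_ne_fun hu.continuous continuous_const).inter (isOpen_lt continuous_const hD.continuous)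
  have hsphere : ∀ x ∈ sphere (0 : E) 1, 0 < ⟪x, u x⟫ := by
    intro x hx
    have hx1 : ‖x‖ = 1 := by simpa using hx
    have h1 := real_inner_le_norm x (p x)
    have h2 := hmaps x (sphere_subset_closedBall hx)
    rw [hx1, one_mul] at h1
    simp only [u, inner_sub_right, real_inner_self_eq_norm_sq, hx1]
    linarith
  have hBU : closedBall (0 : E) 1 ⊆ U := by
    intro x hx
    have hux : u x ≠ 0 := sub_ne_zero.mpr (hfix x hx).symm
    refine ⟨hux, ?_⟩
    have hx1 : ‖x‖ ≤ 1 := by simpa using hx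
    rcases hx1.lt_or_eq with h | h
    · have h3 : 0 < ‖u x‖ := norm_pos_iff.mpr hux
      have h4 : 0 < 1 - ‖x‖ ^ 2 := by nlinarith [norm_nonneg x]
      change 0 < ⟪x, u x⟫ ^ 2 + ‖u x‖ ^ 2 * (1 - ‖x‖ ^ 2)
      positivity
    · have h3 := hsphere x (by simpa using h)
      change 0 < ⟪x, u x⟫ ^ 2 + ‖u x‖ ^ 2 * (1 - ‖x‖ ^ 2)
      rw [h]
      norm_num
      positivity
  have hτ : ContDiffOn ℝ 1 τ U :=
    ((contDiff_id.inner ℝ hu).neg.contDiffOn.add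
      (hD.contDiffOn.sqrt fun x hx => hx.2.ne')).div (hu.norm_sq ℝ).contDiffOn
        fun x hx => by simpa using hx.1
  refine no_contDiffOn_retraction (r := fun x => x + τ x • u x) hU hBU
    (contDiffOn_id.add (hτ.smul hu.contDiffOn)) (fun x hx => ?_) fun x hx => ?_
  · have hxU := hBU hx
    have ha : ‖u x‖ ^ 2 ≠ 0 := by simpa using hxU.1
    have hτx : τ x * ‖u x‖ ^ 2 = -⟪x, u x⟫ + √(D x) := div_mul_cancel₀ _ ha
    have hsq : √(D x) ^ 2 = ⟪x, u x⟫ ^ 2 + ‖u x‖ ^ 2 * (1 - ‖x‖ ^ 2) := Real.sq_sqrt hxU.2.le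
    rw [show √(D x) = τ x * ‖u x‖ ^ 2 + ⟪x, u x⟫ by linarith] at hsq
    rw [← pow_eq_one_iff_of_nonneg (norm_nonneg _) two_ne_zero, norm_add_sq_real, norm_smul,
      inner_smul_right, mul_pow, Real.norm_eq_abs, sq_abs]
    refine mul_left_cancel₀ ha ?_
    linarith
  · have hx1 : ‖x‖ = 1 := by simpa using hx
    simp [τ, D, hx1, Real.sqrt_sq (hsphere x hx).le]

/-- **Brouwer's fixed point theorem** on the closed unit ball. -/
theorem exists_fixedPoint_of_mapsTo_closedBall {E : Type*} [NormedAddCommGroup E]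
    [InnerProductSpace ℝ E] [FiniteDimensional ℝ E] {f : E → E} (hf : Continuous f)
    (hmaps : MapsTo f (closedBall 0 1) (closedBall 0 1)) :
    ∃ x ∈ closedBall (0 : E) 1, f x = x := by
  by_contra! hfix
  have hB : IsCompact (closedBall (0 : E) 1) := isCompact_closedBall 0 1
  obtain ⟨x₀, hx₀, hmin⟩ := hB.exists_isMinOn ⟨0, by simp⟩
    (hf.dist continuous_id).continuousOn
  set ε := dist (f x₀) x₀
  have hεpos : 0 < ε := dist_pos.mpr (hfix x₀ hx₀)
  obtain ⟨q, hq, hqf⟩ := (mem_closure_iff_nhds_basis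
    (nhds_basis_uniformity uniformity_basis_dist.compactConvergenceUniformity)).mp
    (ContinuousMap.dense_setOfPred_contDiff (E := E) (F := E) ⟨f, hf⟩)
    (closedBall 0 1, ε / 2) ⟨hB, half_pos hεpos⟩
  have hqf' : ∀ x ∈ closedBall (0 : E) 1, dist (q x) (f x) < ε / 2 := fun x hx => hqf x hx
  have hη : 0 < 1 + ε / 2 := by positivity
  obtain ⟨x, hx, hpx⟩ := exists_fixedPoint_of_contDiff (p := fun x => (1 + ε / 2)⁻¹ • q x)
    (contDiff_const.smul (ContDiff.of_le (n := ((⊤ : ℕ∞) : WithTop ℕ∞)) hq (by norm_cast)))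
    fun x hx => by
      have h1 := hqf' x hx
      have h2 : ‖f x‖ ≤ 1 := by simpa using hmaps hx
      have h3 : ‖q x‖ < 1 + ε / 2 := by
        rw [dist_eq_norm] at h1
        linarith [norm_sub_norm_le (q x) (f x)]
      rw [norm_smul, norm_inv, Real.norm_of_nonneg hη.le, inv_mul_lt_iff₀ hη]
      linarith
  have hqx : q x = (1 + ε / 2) • x := (inv_smul_eq_iff₀ hη.ne').mp hpx
  have h1 : dist (q x) x ≤ ε / 2 := by
    have hx1 : ‖x‖ ≤ 1 := by simpa using hx
    rw [hqx, dist_eq_norm, add_smul, one_smul, add_sub_cancel_left, norm_smul,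
      Real.norm_of_nonneg (half_pos hεpos).le]
    nlinarith
  have h2 := hqf' x hx
  have h3 : ε ≤ dist (f x) x := hmin hx
  linarith [dist_triangle_left (f x) x (q x)]

/-- The coordinatewise formula for a retraction of `ι → ℝ` onto the standard simplex. -/
noncomputable def stdSimplexRetraction (ι : Type*) [Fintype ι] (w : ι → ℝ) : ι → ℝ := fun i =>
  (max (w i) 0 + max (1 - ∑ j, max (w j) 0) 0 / Fintype.card ι) / max (∑ j, max (w j) 0) 1

theorem continuous_stdSimplexRetraction (ι : Type*) [Fintype ι] :
    Continuous (stdSimplexRetraction ι) := by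
  refine continuous_pi fun i => Continuous.div (by fun_prop) (by fun_prop) fun w => ?_
  exact (lt_max_of_lt_right one_pos).ne'

theorem stdSimplexRetraction_mem {ι : Type*} [Fintype ι] [Nonempty ι] (w : ι → ℝ) :
    stdSimplexRetraction ι w ∈ stdSimplex ℝ ι := by
  refine ⟨fun i => ?_, ?_⟩
  · unfold stdSimplexRetraction
    positivity
  · have hcard : (Fintype.card ι : ℝ) ≠ 0 := by simp
    simp only [stdSimplexRetraction]
    rw [← Finset.sum_div, Finset.sum_add_distrib, Finset.sum_const, Finset.card_univ, nsmul_eq_mul,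
      mul_div_cancel₀ _ hcard, div_eq_one_iff_eq (lt_max_of_lt_right one_pos).ne']
    rcases le_total (∑ j, max (w j) 0) 1 with h | h
    · rw [max_eq_left (by linarith), max_eq_right h]; ring
    · rw [max_eq_right (by linarith), max_eq_left h]; ring

theorem stdSimplexRetraction_of_mem {ι : Type*} [Fintype ι] {w : ι → ℝ}
    (hw : w ∈ stdSimplex ℝ ι) : stdSimplexRetraction ι w = w := by
  ext i
  have h : ∀ j, max (w j) 0 = w j := fun j => max_eq_left (hw.1 j)
  simp [stdSimplexRetraction, h, hw.2]

/-- **Brouwer's fixed point theorem** on the standard simplex. -/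
theorem exists_fixedPoint_of_mapsTo_stdSimplex {ι : Type*} [Fintype ι] [Nonempty ι]
    {φ : (ι → ℝ) → ι → ℝ} (hφ : ContinuousOn φ (stdSimplex ℝ ι))
    (hmaps : MapsTo φ (stdSimplex ℝ ι) (stdSimplex ℝ ι)) :
    ∃ w ∈ stdSimplex ℝ ι, φ w = w := by
  let ρ := stdSimplexRetraction ι
  have hcont : Continuous (φ ∘ ρ) :=
    hφ.comp_continuous (continuous_stdSimplexRetraction ι) stdSimplexRetraction_mem
  have hmem : ∀ w, φ (ρ w) ∈ stdSimplex ℝ ι := fun w => hmaps (stdSimplexRetraction_mem w)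
  obtain ⟨x, -, hx⟩ := exists_fixedPoint_of_mapsTo_closedBall
    (f := fun x : EuclideanSpace ℝ ι => WithLp.toLp 2 (φ (ρ x.ofLp)))
    ((PiLp.continuous_toLp 2 _).comp (hcont.comp (PiLp.continuous_ofLp 2 _))) fun x _ => by
      obtain ⟨h0, h1⟩ := hmem x.ofLp
      rw [mem_closedBall_zero_iff, ← sq_le_one_iff₀ (norm_nonneg _), EuclideanSpace.real_norm_sq_eq]
      refine le_trans (Finset.sum_le_sum fun i _ => ?_) h1.le
      have hi : φ (ρ x.ofLp) i ≤ 1 := h1 ▸ Finset.single_le_sum (fun j _ => h0 j) (Finset.mem_univ i)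
      exact pow_le_of_le_one (h0 i) hi two_ne_zero
  have hx' : φ (ρ x.ofLp) = x.ofLp := congrArg WithLp.ofLp hx
  have hxs : x.ofLp ∈ stdSimplex ℝ ι := hx' ▸ hmem x.ofLp
  refine ⟨x.ofLp, hxs, ?_⟩
  conv_rhs => rw [← hx']
  exact congrArg φ (stdSimplexRetraction_of_mem hxs).symm

theorem exists_mem_convexHull_biUnion_ball {E : Type*} [NormedAddCommGroup E] [NormedSpace ℝ E]
    {C : Set E} (hCc : IsCompact C) (hCv : Convex ℝ C) (hCne : C.Nonempty) {G : E → Set E}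
    (hne : ∀ x ∈ C, (G x).Nonempty) (hsub : ∀ x ∈ C, G x ⊆ C) {ε : ℝ} (hε : 0 < ε) :
    ∃ x ∈ C, x ∈ convexHull ℝ (⋃ z ∈ C ∩ ball x ε, G z) := by
  obtain ⟨t, htC, htf, htcov⟩ := hCc.finite_cover_balls hε
  have := htf.fintype
  choose! y hy using hne
  have hyC : ∀ i : t, y i ∈ C := fun i => hsub _ (htC i.2) (hy _ (htC i.2))
  have : Nonempty t := by
    obtain ⟨a, ha⟩ := hCne
    obtain ⟨i, hi, -⟩ := mem_iUnion₂.mp (htcov ha)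
    exact ⟨⟨i, hi⟩⟩
  let b : t → E → ℝ := fun i x => max (ε - dist x i) 0
  let S : E → ℝ := fun x => ∑ i, b i x
  have hb0 : ∀ i x, 0 ≤ b i x := fun i x => le_max_right _ _
  have hS : ∀ x ∈ C, 0 < S x := by
    intro x hx
    obtain ⟨i, hi, hxi⟩ := mem_iUnion₂.mp (htcov hx)
    refine Finset.sum_pos' (fun j _ => hb0 j x) ⟨⟨i, hi⟩, Finset.mem_univ _, ?_⟩
    exact lt_max_of_lt_left (sub_pos.mpr hxi)
  let q : (t → ℝ) → E := fun w => ∑ i, w i • y i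
  have hq : Continuous q := by fun_prop
  have hqC : ∀ w ∈ stdSimplex ℝ t, q w ∈ C := fun w hw =>
    hCv.sum_mem (fun i _ => hw.1 i) hw.2 fun i _ => hyC i
  obtain ⟨w, hw, hfix⟩ := exists_fixedPoint_of_mapsTo_stdSimplex
    (φ := fun w i => b i (q w) / S (q w))
    (continuousOn_pi.mpr fun i => ContinuousOn.div (by fun_prop) (by fun_prop)
      fun w hw => (hS _ (hqC w hw)).ne')
    (fun w hw => ⟨fun i => div_nonneg (hb0 i _) (hS _ (hqC w hw)).le, by
      rw [← Finset.sum_div]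
      exact div_self (hS _ (hqC w hw)).ne'⟩)
  refine ⟨q w, hqC w hw, ?_⟩
  have hsupp : ∀ i : t, w i ≠ 0 → dist (q w) i < ε := by
    intro i hi
    by_contra! hle
    refine hi ?_
    rw [← hfix]
    have : b i (q w) = 0 := max_eq_right (sub_nonpos.mpr hle)
    simp [this]
  have hqs : ∑ i with w i ≠ 0, w i • (y i : E) = q w :=
    Finset.sum_filter_of_ne fun i _ h => left_ne_zero_of_smul h
  have hmem : ∑ i with w i ≠ 0, w i • (y i : E) ∈
      convexHull ℝ (⋃ z ∈ C ∩ ball (q w) ε, G z) := by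
    refine (convex_convexHull ℝ _).sum_mem (fun i _ => hw.1 i) ?_ fun i hi => ?_
    · rw [Finset.sum_filter_ne_zero, hw.2]
    · refine subset_convexHull ℝ _ (mem_iUnion₂.mpr ⟨i, ⟨htC i.2, ?_⟩, hy _ (htC i.2)⟩)
      rw [mem_ball_comm]
      exact hsupp i (Finset.mem_filter.mp hi).2
  rwa [hqs] at hmem

/-- The **Kakutani–Fan fixed point theorem** in a normed space. -/
theorem exists_mem_of_upperSemicontinuous {E : Type*} [NormedAddCommGroup E] [NormedSpace ℝ E]
    {C : Set E} (hCc : IsCompact C) (hCv : Convex ℝ C) (hCne : C.Nonempty) {G : E → Set E}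
    (hne : ∀ x ∈ C, (G x).Nonempty) (hsub : ∀ x ∈ C, G x ⊆ C) (hcl : ∀ x ∈ C, IsClosed (G x))
    (hconv : ∀ x ∈ C, Convex ℝ (G x))
    (husc : ∀ x ∈ C, ∀ U, IsOpen U → G x ⊆ U → ∀ᶠ x' in 𝓝[C] x, G x' ⊆ U) :
    ∃ x ∈ C, x ∈ G x := by
  choose x hxC hx using fun n : ℕ => exists_mem_convexHull_biUnion_ball hCc hCv hCne hne hsub
    (Nat.one_div_pos_of_nat (α := ℝ) (n := n))
  obtain ⟨a, haC, ψ, hψ, hlim⟩ := hCc.tendsto_subseq hxC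
  refine ⟨a, haC, mem_of_closed' (hcl a haC) |>.mpr fun δ hδ => ?_⟩
  obtain ⟨η, hη, hηU⟩ := Metric.mem_nhdsWithin_iff.mp
    (husc a haC _ isOpen_thickening (self_subset_thickening (half_pos hδ) (G a)))
  have hsmall : ∀ᶠ n in atTop, 1 / ((ψ n : ℝ) + 1) < η / 2 :=
    (tendsto_one_div_add_atTop_nhds_zero_nat.comp hψ.tendsto_atTop).eventually_lt_const
      (half_pos hη)
  obtain ⟨n, hn1, hn2, hn3⟩ := (hsmall.and
    ((Metric.tendsto_nhds.mp hlim _ (half_pos hη)).and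
      (Metric.tendsto_nhds.mp hlim _ (half_pos hδ)))).exists
  have hmem : x (ψ n) ∈ thickening (δ / 2) (G a) := by
    refine convexHull_min (iUnion₂_subset fun z hz => ?_) ((hconv a haC).thickening _) (hx (ψ n))
    refine hηU ⟨?_, hz.1⟩
    have h1 := mem_ball.mp hz.2
    simp only [Function.comp_apply] at hn2
    rw [mem_ball]
    linarith [dist_triangle z (x (ψ n)) a]
  obtain ⟨c, hc, hdc⟩ := mem_thickening_iff.mp hmem
  refine ⟨c, hc, ?_⟩
  simp only [Function.comp_apply] at hn3
  linarith [dist_triangle_left a c (x (ψ n))]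

/-- Martelli-type fixed point theorem (compact-valued specialization): an upper
semicontinuous, completely continuous multivalued map on a real Hilbert space
with nonempty closed bounded convex values, for which the set
`M = {x : λ • x ∈ K x for some λ > 1}` is bounded, has a fixed point. -/
theorem martelli_fixed_point
    {H : Type*} [NormedAddCommGroup H] [InnerProductSpace ℝ H] [CompleteSpace H]
    (K : H → Set H)
    (hne : ∀ x, (K x).Nonempty)
    (hcl : ∀ x, IsClosed (K x))
    (hbd : ∀ x, Bornology.IsBounded (K x))
    (hconv : ∀ x, Convex ℝ (K x))
    (husc : ∀ x : H, ∀ U : Set H, IsOpen U → K x ⊆ U →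
      ∃ V ∈ nhds x, ∀ x' ∈ V, K x' ⊆ U)
    (hcc : ∀ A : Set H, Bornology.IsBounded A →
      IsCompact (closure (⋃ x ∈ A, K x)))
    (hM : Bornology.IsBounded {x : H | ∃ lam : ℝ, 1 < lam ∧ lam • x ∈ K x}) :
    ∃ x : H, x ∈ K x := by
  obtain ⟨R, hR, hMR⟩ := hM.exists_pos_norm_lt
  let P : H → H := fun y => (R / max R ‖y‖) • y
  have hmax : ∀ y : H, 0 < max R ‖y‖ := fun y => lt_max_of_lt_left hR
  have hPc : Continuous P :=
    (continuous_const.div (by fun_prop) fun y => (hmax y).ne').smul continuous_id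
  have hPR : ∀ y, P y ∈ closedBall (0 : H) R := by
    intro y
    rw [mem_closedBall_zero_iff, norm_smul, Real.norm_of_nonneg (div_nonneg hR.le (hmax y).le),
      div_mul_eq_mul_div, div_le_iff₀ (hmax y)]
    gcongr
    exact le_max_right _ _
  let T : Set H := ⋃ x ∈ closedBall (0 : H) R, K x
  have hTb : TotallyBounded T := (hcc _ isBounded_closedBall).totallyBounded.subset subset_closure
  have hKT : ∀ y, K (P y) ⊆ T := fun y => subset_biUnion_of_mem (u := K) (hPR y)
  have hTC : T ⊆ closure (convexHull ℝ T) := (subset_convexHull ℝ T).trans subset_closure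
  obtain ⟨y, -, hy⟩ := exists_mem_of_upperSemicontinuous (G := fun y => K (P y))
    (hTb.convexHull.closure.isCompact_of_isClosed isClosed_closure)
    (convex_convexHull ℝ T).closure (((hne (P 0)).mono (hKT 0)).mono hTC)
    (fun y _ => hne _) (fun y _ => (hKT y).trans hTC) (fun y _ => hcl _) (fun y _ => hconv _)
    fun y _ U hU hyU => by
      obtain ⟨V, hV, hVU⟩ := husc (P y) U hU hyU
      exact nhdsWithin_le_nhds (mem_of_superset (hPc.continuousAt hV) fun z hz => hVU _ hz)
  rcases le_or_gt ‖y‖ R with h | h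
  · have hPy : P y = y := by simp [P, max_eq_left h, div_self hR.ne']
    exact ⟨y, by simpa only [hPy] using hy⟩
  · have hPy : P y = (R / ‖y‖) • y := by simp [P, max_eq_right h.le]
    have hy0 : 0 < ‖y‖ := hR.trans h
    have hlt : ‖P y‖ < R := by
      refine hMR _ ⟨‖y‖ / R, (one_lt_div hR).mpr h, ?_⟩
      have : (‖y‖ / R) • P y = y := by
        rw [hPy, smul_smul, div_mul_div_cancel₀ hR.ne', div_self hy0.ne', one_smul]
      rwa [this]
    rw [hPy, norm_smul, Real.norm_of_nonneg (by positivity), div_mul_cancel₀ _ hy0.ne'] at hlt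
    exact absurd hlt (lt_irrefl R)
end

section
/- Let H be a real Hilbert space and let T : H → H be a bounded self-adjoint nonnegative linear operator (⟨T x, x⟩ ≥ 0 for all x), and for each δ > 0 let R_δ : H → H be the (unique) bounded operator satisfying (δI + T)∘R_δ = I = R_δ∘(δI + T). Then the following are equivalent: (a) δ·R_δ(x) → 0 as δ → 0⁺ for every x ∈ H (i.e. δ(δI + T)^{-1} → 0 in the strong operator topology); (b) the range of T is dense in H. -/
open scoped RealInnerProductSpace

/-- If `T` is nonnegative then `δ (δI + T)⁻¹` is a contraction. -/
lemma norm_smul_le_norm_smul_add_of_inner_nonneg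
    {H : Type*} [NormedAddCommGroup H] [InnerProductSpace ℝ H] {T : H →L[ℝ] H}
    (hT : ∀ x : H, 0 ≤ ⟪T x, x⟫) {δ : ℝ} (hδ : 0 < δ) (y : H) :
    ‖δ • y‖ ≤ ‖δ • y + T y‖ := by
  rw [norm_smul, Real.norm_of_nonneg hδ.le]
  rcases eq_or_ne y 0 with rfl | hy
  · simp
  have h : δ * ‖y‖ * ‖y‖ ≤ ‖δ • y + T y‖ * ‖y‖ := by
    refine le_trans ?_ (real_inner_le_norm (δ • y + T y) y)
    rw [inner_add_left, real_inner_smul_left, real_inner_self_eq_norm_sq]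
    nlinarith [hT y]
  exact le_of_mul_le_mul_right h (norm_pos_iff.mpr hy)

/-- For a bounded self-adjoint nonnegative operator `T` on a real Hilbert space with
resolvents `R δ = (δI + T)⁻¹` (δ > 0), the strong convergence `δ (δI + T)⁻¹ → 0` as
`δ → 0⁺` holds if and only if the range of `T` is dense. -/
theorem strong_resolvent_convergence_iff_dense_range
    {H : Type*} [NormedAddCommGroup H] [InnerProductSpace ℝ H] [CompleteSpace H]
    (T : H →L[ℝ] H)
    (hsa : ∀ x y : H, ⟪T x, y⟫ = ⟪x, T y⟫)
    (hnn : ∀ x : H, 0 ≤ ⟪T x, x⟫)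
    (R : ℝ → H →L[ℝ] H)
    (hR : ∀ δ : ℝ, 0 < δ →
      (δ • ContinuousLinearMap.id ℝ H + T).comp (R δ) = ContinuousLinearMap.id ℝ H ∧
      (R δ).comp (δ • ContinuousLinearMap.id ℝ H + T) = ContinuousLinearMap.id ℝ H) :
    (∀ x : H, Filter.Tendsto (fun δ : ℝ => δ • R δ x)
        (nhdsWithin 0 (Set.Ioi 0)) (nhds 0)) ↔
      Dense (Set.range ⇑T) := by
  have hright : ∀ δ : ℝ, 0 < δ → ∀ x, δ • R δ x + T (R δ x) = x := fun δ hδ x => by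
    simpa using DFunLike.congr_fun (hR δ hδ).1 x
  have hleft : ∀ δ : ℝ, 0 < δ → ∀ x, δ • R δ x + R δ (T x) = x := fun δ hδ x => by
    simpa using DFunLike.congr_fun (hR δ hδ).2 x
  have hcontr : ∀ δ : ℝ, 0 < δ → ∀ x, ‖δ • R δ x‖ ≤ ‖x‖ := fun δ hδ x => by
    simpa only [hright δ hδ x] using
      norm_smul_le_norm_smul_add_of_inner_nonneg hnn hδ (R δ x)
  constructor
  · intro h x
    have hlim : Filter.Tendsto (fun δ : ℝ => x - δ • R δ x)
        (nhdsWithin 0 (Set.Ioi 0)) (nhds x) := by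
      simpa using (h x).const_sub x
    refine mem_closure_of_tendsto hlim ?_
    filter_upwards [self_mem_nhdsWithin] with δ hδ
    exact ⟨R δ x, eq_sub_of_add_eq' (hright δ hδ x)⟩
  · intro hd x
    rw [Metric.tendsto_nhds]
    intro ε hε
    obtain ⟨_, ⟨z, rfl⟩, hz⟩ := Metric.dense_iff.mp hd x (ε / 2) (half_pos hε) |>.imp
      fun _ h => And.intro h.2 h.1
    rw [Metric.mem_ball, dist_comm, dist_eq_norm] at hz
    have hsmall : Filter.Tendsto (fun δ : ℝ => δ * (2 * ‖z‖))
        (nhdsWithin 0 (Set.Ioi 0)) (nhds 0) := by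
      have hc : Continuous fun δ : ℝ => δ * (2 * ‖z‖) := by fun_prop
      simpa using (hc.tendsto 0).mono_left nhdsWithin_le_nhds
    filter_upwards [self_mem_nhdsWithin, hsmall.eventually_lt_const (half_pos hε)]
      with δ hδ hδz
    have hδ' : 0 < δ := hδ
    have hTz : ‖δ • R δ (T z)‖ ≤ δ * (2 * ‖z‖) := by
      rw [eq_sub_of_add_eq' (hleft δ hδ z), norm_smul, Real.norm_of_nonneg hδ'.le]
      have := norm_sub_le z (δ • R δ z)
      have := hcontr δ hδ z
      gcongr
      linarith
    have hsplit : δ • R δ x = δ • R δ (x - T z) + δ • R δ (T z) := by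
      rw [← smul_add, ← map_add, sub_add_cancel]
    rw [dist_zero_right, hsplit]
    have := norm_add_le (δ • R δ (x - T z)) (δ • R δ (T z))
    have := hcontr δ hδ (x - T z)
    linarith
end

section
/- For every real ρ with 0 < ρ < 1 and every real z, the Wright-type series χ_ρ(z) = Σ_{n=0}^{∞} (−z)^n / (n! · Γ(−ρ n + 1 − ρ)) is (absolutely) convergent, i.e. the function n ↦ (−z)^n / (n! · Γ(−ρ n + 1 − ρ)) is summable. -/
open Filter Topology

/-- The bound `|1/Γ(1 - x)| ≤ Γ(x)` for positive `x`, from the reflection formula. -/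
lemma Real.abs_inv_Gamma_one_sub_le {x : ℝ} (hx : 0 < x) :
    |(Real.Gamma (1 - x))⁻¹| ≤ Real.Gamma x := by
  have hG := Real.Gamma_pos_of_pos hx
  rcases eq_or_ne (Real.Gamma (1 - x)) 0 with h | h
  · simpa [h] using hG.le
  have hr := Real.Gamma_mul_Gamma_one_sub x
  have hs : Real.sin (Real.pi * x) ≠ 0 := by
    intro h0
    rw [h0, div_zero] at hr
    exact mul_ne_zero hG.ne' h hr
  have hinv : (Real.Gamma (1 - x))⁻¹ = Real.Gamma x * (Real.sin (Real.pi * x) / Real.pi) := by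
    rw [eq_div_iff hs] at hr
    field_simp
    rw [mul_comm x Real.pi]
    linear_combination -hr
  rw [hinv, abs_mul, abs_of_pos hG, abs_div, abs_of_pos Real.pi_pos]
  refine mul_le_of_le_one_right hG.le ((div_le_one Real.pi_pos).2 ?_)
  linarith [Real.abs_sin_le_one (Real.pi * x), Real.pi_gt_three]

/-- Log-convexity of `Γ` gives `Γ(ρ(n + 1)) ≤ (n + 1)!^ρ / ρ`. -/
lemma Real.Gamma_mul_add_one_le {ρ : ℝ} (h0 : 0 < ρ) (h1 : ρ < 1) (n : ℕ) :
    Real.Gamma (ρ * (n + 1)) ≤ ((n + 1).factorial : ℝ) ^ ρ / ρ := by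
  have hx : 0 < ρ * ((n : ℝ) + 1) := by positivity
  have hG := Real.Gamma_pos_of_pos hx
  have hc := Real.Gamma_mul_add_mul_le_rpow_Gamma_mul_rpow_Gamma
    (s := ((n + 1 : ℕ) : ℝ) + 1) (t := 1) (a := ρ) (b := 1 - ρ)
    (by positivity) one_pos h0 (by linarith) (by ring)
  rw [Real.Gamma_nat_eq_factorial, Real.Gamma_one, Real.one_rpow, mul_one, mul_one,
    show ρ * (((n + 1 : ℕ) : ℝ) + 1) + (1 - ρ) = ρ * ((n : ℝ) + 1) + 1 by push_cast; ring,
    Real.Gamma_add_one hx.ne'] at hc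
  rw [le_div_iff₀ h0]
  have : ρ * 1 ≤ ρ * ((n : ℝ) + 1) := by gcongr; simp
  nlinarith

lemma summable_pow_mul_factorial_rpow_div_factorial {ρ : ℝ} (h1 : ρ < 1) (z : ℝ) :
    Summable fun n : ℕ => z ^ n * ((n + 1).factorial : ℝ) ^ ρ / n.factorial := by
  refine summable_of_ratio_norm_eventually_le (r := 1 / 2) (by norm_num) ?_
  have ht : Tendsto (fun n : ℕ => |z| * ((n + 2 : ℕ) : ℝ) ^ (-(1 - ρ))) atTop (𝓝 (|z| * 0)) :=
    ((tendsto_rpow_neg_atTop (sub_pos.2 h1)).comp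
      (tendsto_natCast_atTop_atTop.comp (tendsto_add_atTop_nat 2))).const_mul _
  rw [mul_zero] at ht
  filter_upwards [ht.eventually_lt_const (show (0 : ℝ) < 1 / 4 by norm_num)] with n hn
  have hpow : ((n + 2 : ℕ) : ℝ) ^ ρ = ((n + 2 : ℕ) : ℝ) * ((n + 2 : ℕ) : ℝ) ^ (-(1 - ρ)) := by
    nth_rewrite 2 [← Real.rpow_one ((n + 2 : ℕ) : ℝ)]
    rw [← Real.rpow_add (by positivity)]
    congr 1; ring
  have hratio : |z| * ((n + 2 : ℕ) : ℝ) ^ ρ / ((n : ℝ) + 1) ≤ 1 / 2 := by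
    rw [div_le_iff₀ (by positivity), hpow]
    push_cast at hn ⊢
    have : (0 : ℝ) ≤ n := n.cast_nonneg
    nlinarith
  have hstep : ((n + 1 + 1).factorial : ℝ) ^ ρ
      = ((n + 2 : ℕ) : ℝ) ^ ρ * ((n + 1).factorial : ℝ) ^ ρ := by
    rw [Nat.factorial_succ (n + 1), Nat.cast_mul, Real.mul_rpow (by positivity) (by positivity)]
  have hfac : ((n + 1).factorial : ℝ) = ((n : ℝ) + 1) * n.factorial := by
    rw [Nat.factorial_succ]; push_cast; ring
  have hF : (0 : ℝ) ≤ ((n + 1).factorial : ℝ) ^ ρ := by positivity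
  have hT : (0 : ℝ) ≤ ((n + 2 : ℕ) : ℝ) ^ ρ := by positivity
  simp only [Real.norm_eq_abs, abs_div, abs_mul, abs_pow, Nat.abs_cast]
  rw [hstep, abs_mul, abs_of_nonneg hF, abs_of_nonneg hT]
  calc |z| ^ (n + 1) * (((n + 2 : ℕ) : ℝ) ^ ρ * ((n + 1).factorial : ℝ) ^ ρ)
        / ((n + 1).factorial : ℝ)
      = (|z| * ((n + 2 : ℕ) : ℝ) ^ ρ / ((n : ℝ) + 1))
        * (|z| ^ n * ((n + 1).factorial : ℝ) ^ ρ / n.factorial) := by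
        generalize ((n + 1).factorial : ℝ) ^ ρ = F
        rw [hfac, div_mul_div_comm]; ring
    _ ≤ _ := by gcongr

/-- For `0 < ρ < 1` and any real `z`, the Wright-type series
`χ_ρ(z) = Σ_{n≥0} (−z)ⁿ / (n! Γ(−ρn + 1 − ρ))` converges absolutely, i.e. the terms
are summable. (Here `Real.Gamma` vanishes... rather, `1/Γ` is interpreted via
Mathlib's `Real.Gamma`, which is `0` at the nonpositive integers.) -/
theorem wright_series_summable (ρ : ℝ) (h0 : 0 < ρ) (h1 : ρ < 1) (z : ℝ) :
    Summable fun n : ℕ =>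
      (-z) ^ n / ((n.factorial : ℝ) * Real.Gamma (-ρ * n + 1 - ρ)) := by
  refine Summable.of_norm_bounded
    ((summable_pow_mul_factorial_rpow_div_factorial h1 |z|).mul_right ρ⁻¹) fun n => ?_
  have hb := (Real.abs_inv_Gamma_one_sub_le (x := ρ * (n + 1)) (by positivity)).trans
    (Real.Gamma_mul_add_one_le h0 h1 n)
  rw [show -ρ * n + 1 - ρ = 1 - ρ * (n + 1) by ring, Real.norm_eq_abs, abs_div, abs_mul, abs_pow,
    abs_neg, Nat.abs_cast, ← div_div, div_eq_mul_inv _ |Real.Gamma _|, ← abs_inv]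
  calc _ ≤ |z| ^ n / n.factorial * (((n + 1).factorial : ℝ) ^ ρ / ρ) := by gcongr
    _ = _ := by ring
end
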